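/- For probability densities p, q on R^d with finite second moments (p absolutely continuous with respect to Lebesgue measure), the Wasserstein-2 distance satisfies W_2^2(p, q) = min over measurable maps T with T_# p = q of E_{x ~ p} ||x - T(x)||^2, and this Monge minimum equals the Kantorovich optimal coupling cost. -/

import Mathlib

open MeasureTheory
noncomputable section

/-- Squared Wasserstein-2 distance (Kantorovich formulation, over couplings). -/
noncomputable def W2sq {d : ℕ} (μ ν : Measure (EuclideanSpace ℝ (Fin d))) : ℝ :=
  sInf {c : ℝ | ∃ pl : Measure (EuclideanSpace ℝ (Fin d) × EuclideanSpace ℝ (Fin d)),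
    pl.map Prod.fst = μ ∧ pl.map Prod.snd = ν ∧ c = ∫ z, ‖z.1 - z.2‖ ^ 2 ∂pl}

open Set Topology
open scoped ENNReal NNReal ProbabilityTheory

section WeakCompactness

variable {X Y : Type*} [TopologicalSpace X] [MeasurableSpace X] [TopologicalSpace Y]
  [MeasurableSpace Y]

/-- Integration of a nonnegative continuous function is lower semicontinuous for the weak topology
on probability measures. -/
theorem lowerSemicontinuous_lintegral_probabilityMeasure [OpensMeasurableSpace X] {f : X → ℝ≥0}
    (hf : Continuous f) :
    LowerSemicontinuous fun μ : ProbabilityMeasure X ↦ ∫⁻ x, (f x : ℝ≥0∞) ∂(μ : Measure X) := by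
  have heq : (fun μ : ProbabilityMeasure X ↦ ∫⁻ x, (f x : ℝ≥0∞) ∂(μ : Measure X)) =
      fun μ : ProbabilityMeasure X ↦
        ⨆ n : ℕ, ∫⁻ x, ((min (f x) n : ℝ≥0) : ℝ≥0∞) ∂(μ : Measure X) := by
    funext μ
    rw [← lintegral_iSup]
    · refine lintegral_congr fun x ↦ le_antisymm ?_ ?_
      · obtain ⟨n, hn⟩ := exists_nat_ge (f x)
        exact le_iSup_of_le n (by simp [min_eq_left hn])
      · exact iSup_le fun n ↦ by exact_mod_cast min_le_left _ _
    · intro n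
      exact (hf.min continuous_const).measurable.coe_nnreal_ennreal
    · intro m n hmn x
      have : (m : ℝ≥0) ≤ n := by exact_mod_cast hmn
      exact ENNReal.coe_le_coe.2 (min_le_min_left _ this)
  rw [heq]
  refine lowerSemicontinuous_iSup fun n ↦ Continuous.lowerSemicontinuous ?_
  let g : BoundedContinuousFunction X ℝ≥0 :=
    BoundedContinuousFunction.mkOfBound ⟨fun x ↦ min (f x) n, hf.min continuous_const⟩ n (by
      intro x y
      rw [NNReal.dist_eq, abs_sub_le_iff]
      have h (z : X) : ((min (f z) n : ℝ≥0) : ℝ) ≤ n := by exact_mod_cast min_le_right _ _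
      have hx := h x
      have hy := h y
      have hx' := (min (f x) n).coe_nonneg
      have hy' := (min (f y) n).coe_nonneg
      simp only [ContinuousMap.coe_mk]
      constructor <;> linarith)
  exact ProbabilityMeasure.continuous_lintegral_boundedContinuousFunction g

variable [PolishSpace X] [BorelSpace X] [PolishSpace Y] [BorelSpace Y]

/-- Couplings of two probability measures on Polish spaces form a weakly compact set. -/
theorem isCompact_couplings (μ : ProbabilityMeasure X) (ν : ProbabilityMeasure Y) :
    IsCompact {π : ProbabilityMeasure (X × Y) |
      (π : Measure (X × Y)).map Prod.fst = μ ∧ (π : Measure (X × Y)).map Prod.snd = ν} := by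
  set S := {π : ProbabilityMeasure (X × Y) |
      (π : Measure (X × Y)).map Prod.fst = μ ∧ (π : Measure (X × Y)).map Prod.snd = ν} with hS
  have hclosed : IsClosed S := by
    have h : S = {π | π.map continuous_fst.measurable.aemeasurable = μ} ∩
        {π | π.map continuous_snd.measurable.aemeasurable = ν} := by
      ext π
      exact ⟨fun h ↦ ⟨Subtype.ext h.1, Subtype.ext h.2⟩,
        fun h ↦ ⟨congrArg Subtype.val h.1, congrArg Subtype.val h.2⟩⟩
    rw [h]
    exact (isClosed_eq (ProbabilityMeasure.continuous_map continuous_fst) continuous_const).inter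
      (isClosed_eq (ProbabilityMeasure.continuous_map continuous_snd) continuous_const)
  rw [← hclosed.closure_eq]
  apply isCompact_closure_of_isTightMeasureSet
  apply IsTightMeasureSet.prodMk
  · refine (isTightMeasureSet_singleton (μ := (μ : Measure X))).subset ?_
    rintro _ ⟨_, ⟨π, hπ, rfl⟩, rfl⟩
    exact hπ.1
  · refine (isTightMeasureSet_singleton (μ := (ν : Measure Y))).subset ?_
    rintro _ ⟨_, ⟨π, hπ, rfl⟩, rfl⟩
    exact hπ.2

/-- The Kantorovich problem with a continuous nonnegative cost has a minimizer. -/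
theorem exists_optimal_coupling (μ : Measure X) (ν : Measure Y) [IsProbabilityMeasure μ]
    [IsProbabilityMeasure ν] {c : X × Y → ℝ≥0} (hc : Continuous c) :
    ∃ π : Measure (X × Y), π.map Prod.fst = μ ∧ π.map Prod.snd = ν ∧
      ∀ ρ : Measure (X × Y), ρ.map Prod.fst = μ → ρ.map Prod.snd = ν →
        ∫⁻ z, (c z : ℝ≥0∞) ∂π ≤ ∫⁻ z, (c z : ℝ≥0∞) ∂ρ := by
  obtain ⟨π, hπ, hmin⟩ := LowerSemicontinuousOn.exists_isMinOn
    (s := {π : ProbabilityMeasure (X × Y) |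
      (π : Measure (X × Y)).map Prod.fst = μ ∧ (π : Measure (X × Y)).map Prod.snd = ν})
    ⟨⟨μ.prod ν, inferInstance⟩, by simp [Measure.map_fst_prod], by simp [Measure.map_snd_prod]⟩
    (isCompact_couplings ⟨μ, inferInstance⟩ ⟨ν, inferInstance⟩)
    ((lowerSemicontinuous_lintegral_probabilityMeasure hc).lowerSemicontinuousOn _)
  refine ⟨π, hπ.1, hπ.2, fun ρ h₁ h₂ ↦ ?_⟩
  have : IsProbabilityMeasure ρ := by
    have : IsProbabilityMeasure (ρ.map Prod.fst) := h₁ ▸ inferInstance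
    exact Measure.isProbabilityMeasure_of_map Prod.fst
  exact hmin (show (⟨ρ, this⟩ : ProbabilityMeasure (X × Y)) ∈ _ from ⟨h₁, h₂⟩)

end WeakCompactness

section Monotone

/-- The squared distance of two square integrable random vectors is integrable. -/
theorem integrable_norm_sub_sq {E Ω : Type*} [NormedAddCommGroup E] [MeasurableSpace E]
    [BorelSpace E] [SecondCountableTopology E] [MeasurableSpace Ω] {m : Measure Ω} {X Y : Ω → E}
    (hX : Measurable X) (hY : Measurable Y) (hX2 : Integrable (fun ω ↦ ‖X ω‖ ^ 2) m)
    (hY2 : Integrable (fun ω ↦ ‖Y ω‖ ^ 2) m) : Integrable (fun ω ↦ ‖X ω - Y ω‖ ^ 2) m := by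
  rw [← memLp_two_iff_integrable_sq_norm hX.aestronglyMeasurable] at hX2
  rw [← memLp_two_iff_integrable_sq_norm hY.aestronglyMeasurable] at hY2
  exact (memLp_two_iff_integrable_sq_norm
    (hX.sub hY).aestronglyMeasurable).1 (hX2.sub hY2)

variable {E : Type*} [NormedAddCommGroup E] [InnerProductSpace ℝ E]

/-- Pairs of points of `E × E` violating monotonicity. -/
def nonmonotonePairs (E : Type*) [NormedAddCommGroup E] [InnerProductSpace ℝ E] :
    Set ((E × E) × (E × E)) :=
  {w | inner ℝ (w.1.1 - w.2.1) (w.1.2 - w.2.2) < 0}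

theorem isOpen_nonmonotonePairs : IsOpen (nonmonotonePairs E) :=
  isOpen_lt (by fun_prop) continuous_const

theorem swap_mem_nonmonotonePairs {w : (E × E) × (E × E)} :
    w.swap ∈ nonmonotonePairs E ↔ w ∈ nonmonotonePairs E := by
  simp only [nonmonotonePairs, mem_ofPred_eq, Prod.fst_swap, Prod.snd_swap]
  rw [← neg_sub w.1.1, ← neg_sub w.1.2, inner_neg_neg]

/-- If almost all pairs of points are monotone, then so are all pairs of points of the support. -/
theorem inner_nonneg_of_mem_support [MeasurableSpace E] {π : Measure (E × E)} [SFinite π]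
    (h : (π.prod π) (nonmonotonePairs E) = 0) {z w : E × E} (hz : z ∈ π.support)
    (hw : w ∈ π.support) : 0 ≤ inner ℝ (z.1 - w.1) (z.2 - w.2) := by
  by_contra! hlt
  have hmem : nonmonotonePairs E ∈ 𝓝 (z, w) := isOpen_nonmonotonePairs.mem_nhds hlt
  obtain ⟨U, hU, V, hV, hUV⟩ := mem_nhds_prod_iff.1 hmem
  have hprod : (π.prod π) (U ×ˢ V) = 0 := measure_mono_null hUV h
  rw [Measure.prod_prod, mul_eq_zero] at hprod
  rw [Measure.mem_support_iff_forall] at hz hw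
  exact hprod.elim (hz U hU).ne' (hw V hV).ne'

open Classical in
/-- Exchange the second components of a pair of points if this lowers the quadratic cost, and
return the first of the two resulting points. -/
def exchange (w : (E × E) × (E × E)) : E × E :=
  (w.1.1, if w ∈ nonmonotonePairs E then w.2.2 else w.1.2)

variable [MeasurableSpace E] [BorelSpace E] [SecondCountableTopology E]

theorem measurable_exchange : Measurable (exchange (E := E)) :=
  (by fun_prop : Measurable fun w : (E × E) × (E × E) ↦ w.1.1).prodMk
    (Measurable.ite isOpen_nonmonotonePairs.measurableSet (by fun_prop) (by fun_prop))

theorem map_fst_map_exchange (π : Measure (E × E)) [IsProbabilityMeasure π] :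
    ((π.prod π).map exchange).map Prod.fst = π.map Prod.fst := by
  rw [Measure.map_map measurable_fst measurable_exchange]
  have : (Prod.fst ∘ exchange : (E × E) × (E × E) → E) = Prod.fst ∘ Prod.fst := rfl
  rw [this, ← Measure.map_map measurable_fst measurable_fst, Measure.map_fst_prod]
  simp

theorem map_snd_map_exchange (π : Measure (E × E)) [IsProbabilityMeasure π] :
    ((π.prod π).map exchange).map Prod.snd = π.map Prod.snd := by
  have hS : MeasurableSet (nonmonotonePairs E) := isOpen_nonmonotonePairs.measurableSet
  have hfst : π.map Prod.snd = (π.prod π).map (fun w ↦ w.1.2) := by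
    have : (fun w : (E × E) × (E × E) ↦ w.1.2) = Prod.snd ∘ Prod.fst := rfl
    rw [this, ← Measure.map_map measurable_snd measurable_fst, Measure.map_fst_prod]
    simp
  rw [Measure.map_map measurable_snd measurable_exchange, hfst]
  ext A hA
  rw [Measure.map_apply (measurable_snd.comp measurable_exchange) hA,
    Measure.map_apply (by fun_prop) hA, ← measure_inter_add_sdiff _ hS,
    ← measure_inter_add_sdiff ((fun w : (E × E) × (E × E) ↦ w.1.2) ⁻¹' A) hS]
  congr 1
  · have hm : MeasurableSet ((fun w : (E × E) × (E × E) ↦ w.1.2) ⁻¹' A ∩ nonmonotonePairs E) :=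
      (measurableSet_preimage (by fun_prop) hA).inter hS
    rw [← (Measure.measurePreserving_swap (μ := π) (ν := π)).measure_preimage
      hm.nullMeasurableSet]
    congr 1
    ext w
    simp only [exchange, mem_inter_iff, mem_preimage, Function.comp_apply,
      swap_mem_nonmonotonePairs, Prod.fst_swap]
    refine and_congr_left fun hw ↦ ?_
    simp [hw]
  · congr 1
    ext w
    simp only [exchange, mem_sdiff, mem_preimage, Function.comp_apply]
    refine and_congr_left fun hw ↦ ?_
    simp [hw]

/-- Under a coupling that is optimal for the quadratic cost, almost all pairs of points are
monotone. -/
theorem prod_nonmonotonePairs_eq_zero {π : Measure (E × E)} [IsProbabilityMeasure π]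
    (h₁ : Integrable (fun z ↦ ‖z.1‖ ^ 2) π) (h₂ : Integrable (fun z ↦ ‖z.2‖ ^ 2) π)
    (hopt : ∀ ρ : Measure (E × E), ρ.map Prod.fst = π.map Prod.fst →
      ρ.map Prod.snd = π.map Prod.snd →
      ∫ z, ‖z.1 - z.2‖ ^ 2 ∂π ≤ ∫ z, ‖z.1 - z.2‖ ^ 2 ∂ρ) :
    (π.prod π) (nonmonotonePairs E) = 0 := by
  have hS : MeasurableSet (nonmonotonePairs E) := isOpen_nonmonotonePairs.measurableSet
  set D : (E × E) × (E × E) → ℝ :=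
    (nonmonotonePairs E).indicator fun w ↦ ‖w.1.1 - w.2.2‖ ^ 2 - ‖w.1.1 - w.1.2‖ ^ 2 with hD
  have hcost : Integrable (fun w : (E × E) × (E × E) ↦ ‖w.1.1 - w.1.2‖ ^ 2) (π.prod π) :=
    integrable_norm_sub_sq (by fun_prop) (by fun_prop) (h₁.comp_fst π) (h₂.comp_fst π)
  have hcross : Integrable (fun w : (E × E) × (E × E) ↦ ‖w.1.1 - w.2.2‖ ^ 2) (π.prod π) :=
    integrable_norm_sub_sq (by fun_prop) (by fun_prop) (h₁.comp_fst π) (h₂.comp_snd π)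
  have hDint : Integrable D (π.prod π) := (hcross.sub hcost).indicator hS
  have hexch (w : (E × E) × (E × E)) :
      ‖(exchange w).1 - (exchange w).2‖ ^ 2 = ‖w.1.1 - w.1.2‖ ^ 2 + D w := by
    by_cases hw : w ∈ nonmonotonePairs E <;> simp [exchange, hD, hw]
  have hDnonneg : 0 ≤ ∫ w, D w ∂(π.prod π) := by
    have h := hopt _ (map_fst_map_exchange π) (map_snd_map_exchange π)
    rw [integral_map measurable_exchange.aemeasurable (by fun_prop)] at h
    simp_rw [hexch] at h
    rw [integral_add hcost hDint] at h
    have hfst : ∫ w : (E × E) × (E × E), ‖w.1.1 - w.1.2‖ ^ 2 ∂(π.prod π) =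
        ∫ z, ‖z.1 - z.2‖ ^ 2 ∂π := by
      simpa using integral_fun_fst (μ := π) (ν := π) fun z : E × E ↦ ‖z.1 - z.2‖ ^ 2
    linarith
  have hsymm : ∫ w, D w.swap ∂(π.prod π) = ∫ w, D w ∂(π.prod π) :=
    integral_prod_swap D
  have hDswap : Integrable (fun w ↦ D w.swap) (π.prod π) := hDint.swap
  have hsum (w : (E × E) × (E × E)) : D w + D w.swap =
      (nonmonotonePairs E).indicator
        (fun w ↦ 2 * inner ℝ (w.1.1 - w.2.1) (w.1.2 - w.2.2)) w := by
    by_cases hw : w ∈ nonmonotonePairs E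
    · simp only [hD, indicator_of_mem hw, indicator_of_mem (swap_mem_nonmonotonePairs.2 hw),
        Prod.fst_swap, Prod.snd_swap, norm_sub_sq_real, inner_sub_left, inner_sub_right]
      ring
    · have hw' : w.swap ∉ nonmonotonePairs E := mt swap_mem_nonmonotonePairs.1 hw
      simp [hD, hw, hw']
  have hneg : 0 ≤ fun w ↦ -(D w + D w.swap) := by
    intro w
    simp only [hsum, Pi.zero_apply, Left.nonneg_neg_iff]
    refine indicator_nonpos (fun w hw ↦ ?_) w
    have : inner ℝ (w.1.1 - w.2.1) (w.1.2 - w.2.2) < 0 := hw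
    linarith
  have hzero : ∫ w, -(D w + D w.swap) ∂(π.prod π) = 0 := by
    refine le_antisymm ?_ (integral_nonneg hneg)
    rw [integral_neg, integral_add hDint hDswap, hsymm]
    linarith
  rw [integral_eq_zero_iff_of_nonneg hneg (hDint.add hDswap).neg] at hzero
  refine measure_mono_null ?_ (ae_iff.1 hzero)
  intro w hw
  have : inner ℝ (w.1.1 - w.2.1) (w.1.2 - w.2.2) < 0 := hw
  simp only [mem_ofPred_eq, hsum, indicator_of_mem hw, Pi.zero_apply]
  linarith

end Monotone

section SingleValued

variable {E : Type*} [NormedAddCommGroup E] [InnerProductSpace ℝ E]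

/-- On each line parallel to `e`, a monotone relation takes values differing in direction `e` at
only countably many points. -/
theorem countable_setOf_multivalued_on_line {Γ : Set (E × E)}
    (hΓ : ∀ z ∈ Γ, ∀ w ∈ Γ, 0 ≤ inner ℝ (z.1 - w.1) (z.2 - w.2)) (e x : E) :
    {t : ℝ | ∃ y y', (x + t • e, y) ∈ Γ ∧ (x + t • e, y') ∈ Γ ∧
      inner ℝ e y < inner ℝ e y'}.Countable := by
  set S := {t : ℝ | ∃ y y', (x + t • e, y) ∈ Γ ∧ (x + t • e, y') ∈ Γ ∧
      inner ℝ e y < inner ℝ e y'}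
  choose! y y' hy hy' hlt using fun t (ht : t ∈ S) ↦ ht
  have hmono {s t : ℝ} (hs : s ∈ S) (ht : t ∈ S) (hst : s < t) :
      inner ℝ e (y' s) ≤ inner ℝ e (y t) := by
    have h := hΓ _ (hy t ht) _ (hy' s hs)
    have heq : x + t • e - (x + s • e) = (t - s) • e := by module
    rw [heq, real_inner_smul_left, inner_sub_right] at h
    have := nonneg_of_mul_nonneg_right h (sub_pos.2 hst)
    linarith
  refine PairwiseDisjoint.countable_of_isOpen
    (s := fun t ↦ Ioo (inner ℝ e (y t)) (inner ℝ e (y' t))) ?_ (fun _ _ ↦ isOpen_Ioo)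
    (fun t ht ↦ nonempty_Ioo.2 (hlt t ht))
  intro s hs t ht hne
  refine Set.disjoint_left.2 fun r hr hr' ↦ ?_
  rcases lt_or_gt_of_ne hne with h | h
  · exact absurd (hmono hs ht h) (by linarith [hr.2, hr'.1])
  · exact absurd (hmono ht hs h) (by linarith [hr.1, hr'.2])

variable [FiniteDimensional ℝ E] [MeasurableSpace E] [BorelSpace E]

/-- The set of points at which a closed relation takes two values differing in direction `e` is
measurable. -/
theorem measurableSet_setOf_multivalued {Γ : Set (E × E)} (hΓ : IsClosed Γ) (e : E) :
    MeasurableSet {x : E | ∃ y y', (x, y) ∈ Γ ∧ (x, y') ∈ Γ ∧ inner ℝ e y < inner ℝ e y'} := by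
  have heq : {x : E | ∃ y y', (x, y) ∈ Γ ∧ (x, y') ∈ Γ ∧ inner ℝ e y < inner ℝ e y'} =
      ⋃ n : ℕ, (fun w : E × E × E ↦ w.1) '' {w | (w.1, w.2.1) ∈ Γ ∧ (w.1, w.2.2) ∈ Γ ∧
        inner ℝ e w.2.1 + 1 / ((n : ℝ) + 1) ≤ inner ℝ e w.2.2} := by
    ext x
    simp only [mem_ofPred_eq, mem_iUnion, mem_image, Prod.exists]
    constructor
    · rintro ⟨y, y', h, h', hlt⟩
      obtain ⟨n, hn⟩ := exists_nat_one_div_lt (sub_pos.2 hlt)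
      exact ⟨n, x, y, y', ⟨h, h', by linarith⟩, rfl⟩
    · rintro ⟨n, _, y, y', ⟨h, h', hle⟩, rfl⟩
      have : (0 : ℝ) < 1 / ((n : ℝ) + 1) := by positivity
      exact ⟨y, y', h, h', by linarith⟩
  rw [heq]
  refine MeasurableSet.iUnion fun n ↦ ?_
  have hclosed : IsClosed {w : E × E × E | (w.1, w.2.1) ∈ Γ ∧ (w.1, w.2.2) ∈ Γ ∧
      inner ℝ e w.2.1 + 1 / ((n : ℝ) + 1) ≤ inner ℝ e w.2.2} :=
    (hΓ.preimage (by fun_prop : Continuous fun w : E × E × E ↦ (w.1, w.2.1))).inter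
      ((hΓ.preimage (by fun_prop : Continuous fun w : E × E × E ↦ (w.1, w.2.2))).inter
        (isClosed_le
          (by fun_prop : Continuous fun w : E × E × E ↦ inner ℝ e w.2.1 + 1 / ((n : ℝ) + 1))
          (by fun_prop : Continuous fun w : E × E × E ↦ inner ℝ e w.2.2)))
  obtain ⟨K, hK, hKU⟩ := (isSigmaCompact_univ.of_isClosed_subset hclosed (subset_univ _)).image
    continuous_fst
  rw [← hKU]
  exact MeasurableSet.iUnion fun k ↦ (hK k).measurableSet

/-- A closed monotone relation on a Euclidean space is single-valued almost everywhere. -/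
theorem ae_singleValued_of_monotone {Γ : Set (E × E)} (hclosed : IsClosed Γ)
    (hΓ : ∀ z ∈ Γ, ∀ w ∈ Γ, 0 ≤ inner ℝ (z.1 - w.1) (z.2 - w.2)) (μ : Measure E)
    [μ.IsAddHaarMeasure] :
    ∀ᵐ x ∂μ, ∀ y y', (x, y) ∈ Γ → (x, y') ∈ Γ → y = y' := by
  have hdir (e : E) : ∀ᵐ x ∂μ, x ∈ {x : E | ∃ y y', (x, y) ∈ Γ ∧ (x, y') ∈ Γ ∧
      inner ℝ e y < inner ℝ e y'}ᶜ := by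
    refine ae_mem_of_ae_add_linearMap_mem (LinearMap.toSpanSingleton ℝ E e) volume μ
      (measurableSet_setOf_multivalued hclosed e).compl fun x ↦ ?_
    exact ((countable_setOf_multivalued_on_line hΓ e x).ae_notMem volume).mono fun t ht ↦ ht
  let b := stdOrthonormalBasis ℝ E
  filter_upwards [ae_all_iff.2 fun i ↦ hdir (b i)] with x hx y y' hy hy'
  refine InnerProductSpace.ext_inner_left_basis b.toBasis fun i ↦ ?_
  simp only [OrthonormalBasis.coe_toBasis]
  refine le_antisymm ?_ ?_
  · by_contra! hlt
    exact hx i ⟨y', y, hy', hy, hlt⟩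
  · by_contra! hlt
    exact hx i ⟨y, y', hy, hy', hlt⟩

end SingleValued

/-- A measure on a product concentrated on a measurable set whose fibres have at most one point
over almost every base point is concentrated on the graph of a measurable map. -/
theorem exists_measurable_ae_eq_of_singleValued {X E : Type*} [MeasurableSpace X]
    [NormedAddCommGroup E] [NormedSpace ℝ E] [CompleteSpace E] [SecondCountableTopology E]
    [MeasurableSpace E] [BorelSpace E] {π : Measure (X × E)} [IsFiniteMeasure π]
    {Γ : Set (X × E)} (hΓ : MeasurableSet Γ) (hmem : ∀ᵐ z ∂π, z ∈ Γ)
    (hsingle : ∀ᵐ x ∂π.map Prod.fst, ∀ y y', (x, y) ∈ Γ → (x, y') ∈ Γ → y = y') :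
    ∃ T : X → E, Measurable T ∧ ∀ᵐ z ∂π, z.2 = T z.1 := by
  have hT : Measurable fun x ↦ ∫ y, y ∂(π.condKernel x) :=
    (StronglyMeasurable.integral_kernel_prod_right' (κ := π.condKernel)
      (f := fun z : X × E ↦ z.2) measurable_snd.stronglyMeasurable).measurable
  refine ⟨_, hT, ?_⟩
  have hmem' := hmem
  rw [← π.disintegrate π.condKernel, Measure.ae_compProd_iff (p := (· ∈ Γ)) hΓ] at hmem'
  suffices h : ∀ᵐ z ∂(π.fst ⊗ₘ π.condKernel), z.2 = ∫ y, y ∂(π.condKernel z.1) by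
    rwa [π.disintegrate π.condKernel] at h
  refine (Measure.ae_compProd_iff
    (measurableSet_eq_fun measurable_snd (hT.comp measurable_fst))).2 ?_
  filter_upwards [hmem', hsingle] with x hx hs
  filter_upwards [hx] with y hy
  have hconst : ∀ᵐ y' ∂(π.condKernel x), y' = y := hx.mono fun y' hy' ↦ hs _ _ hy' hy
  simp [integral_congr_ae hconst]

/-- Brenier / Monge–Kantorovich equivalence: for `p` absolutely continuous with finite
second moment, the Monge problem `min_{T_#p = q} E_p‖x - T(x)‖²` is attained and its
minimum equals the Kantorovich value `W₂²(p, q)`. -/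
theorem monge_kantorovich_equivalence {d : ℕ}
    (p q : Measure (EuclideanSpace ℝ (Fin d)))
    [IsProbabilityMeasure p] [IsProbabilityMeasure q]
    (hpac : p ≪ volume) (hqac : q ≪ volume)
    (hp2 : Integrable (fun x => ‖x‖ ^ 2) p) (hq2 : Integrable (fun x => ‖x‖ ^ 2) q) :
    IsLeast {c : ℝ | ∃ T : EuclideanSpace ℝ (Fin d) → EuclideanSpace ℝ (Fin d),
        Measurable T ∧ p.map T = q ∧ c = ∫ x, ‖x - T x‖ ^ 2 ∂p}
      (W2sq p q) := by
  set E := EuclideanSpace ℝ (Fin d)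
  have hint₁ {ρ : Measure (E × E)} (h : ρ.map Prod.fst = p) :
      Integrable (fun z ↦ ‖z.1‖ ^ 2) ρ :=
    (show Integrable (fun x ↦ ‖x‖ ^ 2) (ρ.map Prod.fst) from h ▸ hp2).comp_measurable
      measurable_fst
  have hint₂ {ρ : Measure (E × E)} (h : ρ.map Prod.snd = q) :
      Integrable (fun z ↦ ‖z.2‖ ^ 2) ρ :=
    (show Integrable (fun x ↦ ‖x‖ ^ 2) (ρ.map Prod.snd) from h ▸ hq2).comp_measurable
      measurable_snd
  obtain ⟨π, hfst, hsnd, hmin⟩ := exists_optimal_coupling p q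
    (c := fun z : E × E ↦ ‖z.1 - z.2‖₊ ^ 2) (by fun_prop)
  have hopt (ρ : Measure (E × E)) (h₁ : ρ.map Prod.fst = p) (h₂ : ρ.map Prod.snd = q) :
      ∫ z, ‖z.1 - z.2‖ ^ 2 ∂π ≤ ∫ z, ‖z.1 - z.2‖ ^ 2 ∂ρ := by
    have hρ : Integrable (fun z : E × E ↦ ‖z.1 - z.2‖ ^ 2) ρ :=
      integrable_norm_sub_sq measurable_fst measurable_snd (hint₁ h₁) (hint₂ h₂)
    have hcoe (z : E × E) :
        ((‖z.1 - z.2‖₊ ^ 2 : ℝ≥0) : ℝ≥0∞) = ENNReal.ofReal (‖z.1 - z.2‖ ^ 2) := by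
      rw [← coe_nnnorm, ← NNReal.coe_pow, ENNReal.ofReal_coe_nnreal]
    have h := hmin ρ h₁ h₂
    simp_rw [hcoe] at h
    rw [integral_eq_lintegral_of_nonneg_ae (ae_of_all _ fun _ ↦ by positivity) (by fun_prop),
      integral_eq_lintegral_of_nonneg_ae (ae_of_all _ fun _ ↦ by positivity) (by fun_prop)]
    exact ENNReal.toReal_mono hρ.lintegral_lt_top.ne h
  have hW : W2sq p q = ∫ z, ‖z.1 - z.2‖ ^ 2 ∂π := by
    refine IsLeast.csInf_eq ⟨⟨π, hfst, hsnd, rfl⟩, ?_⟩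
    rintro _ ⟨ρ, h₁, h₂, rfl⟩
    exact hopt ρ h₁ h₂
  rw [hW]
  constructor
  · have : IsProbabilityMeasure π := by
      have : IsProbabilityMeasure (π.map Prod.fst) := hfst ▸ inferInstance
      exact Measure.isProbabilityMeasure_of_map Prod.fst
    have hzero := prod_nonmonotonePairs_eq_zero (hint₁ hfst) (hint₂ hsnd)
      fun ρ h₁ h₂ ↦ hopt ρ (h₁.trans hfst) (h₂.trans hsnd)
    have hsingle := ae_singleValued_of_monotone π.isClosed_support
      (fun z hz w hw ↦ inner_nonneg_of_mem_support hzero hz hw) (volume : Measure E)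
    obtain ⟨T, hT, hgraph⟩ := exists_measurable_ae_eq_of_singleValued
      π.isClosed_support.measurableSet Measure.support_mem_ae (hfst ▸ hpac.ae_le hsingle)
    refine ⟨T, hT, ?_, ?_⟩
    · rw [← hfst, Measure.map_map hT measurable_fst, ← hsnd]
      exact Measure.map_congr (hgraph.mono fun z hz ↦ hz.symm)
    · rw [← hfst, integral_map measurable_fst.aemeasurable (by fun_prop)]
      refine integral_congr_ae (hgraph.mono fun z hz ↦ ?_)
      simp only [hz]
  · rintro _ ⟨T, hT, hmap, rfl⟩
    have hgraph : Measurable fun x ↦ (x, T x) := measurable_id.prodMk hT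
    have h := hopt (p.map fun x ↦ (x, T x))
      (by rw [Measure.map_map measurable_fst hgraph]; exact Measure.map_id)
      (by rw [Measure.map_map measurable_snd hgraph]; exact hmap)
    rwa [integral_map hgraph.aemeasurable (by fun_prop)] at h
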